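/- arXiv:1010.4664 — 2 statements merged into one kernel-verified Lean document; each statement's English description precedes it below -/
import Mathlib

section
/- Let P be a nonconstant polynomial with complex coefficients. Then Π_0(P) = { ζ ↦ P(Aζ + C) : A a real number with A > 0, C ∈ ℂ }. -/
open Filter Topology Complex

noncomputable section

/-- Locally uniform convergence on `ℂ` with respect to the spherical metric,
expressed via the Euclidean criterion: near every point, either the functions
converge uniformly to `g` in the Euclidean metric, or they are eventually
nonvanishing there and their reciprocals converge uniformly to `1/g`. -/
def SphLocUnifConv (F : ℕ → ℂ → ℂ) (g : ℂ → ℂ) : Prop :=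
  ∀ z₀ : ℂ, ∃ U ∈ 𝓝 z₀,
    TendstoUniformlyOn F g atTop U ∨
    ((∀ᶠ n in atTop, ∀ w ∈ U, F n w ≠ 0) ∧
      TendstoUniformlyOn (fun n w => (F n w)⁻¹) (fun w => (g w)⁻¹) atTop U)

/-- `Π_α(h)` : the set of all nonconstant meromorphic functions `g` on `ℂ` for which
there exist `z₀ ∈ ℂ`, naturals `k n → ∞`, complex `z n → z₀` and positive reals
`ρ n → 0` such that `ζ ↦ ρ n ^ (-α) * h (k n * z n + k n * ρ n * ζ)` converges to `g`
locally uniformly on `ℂ` in the spherical metric. -/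
def PiAlpha (α : ℝ) (h : ℂ → ℂ) : Set (ℂ → ℂ) :=
  { g | MeromorphicOn g Set.univ ∧ (∀ c : ℂ, g ≠ fun _ => c) ∧
      ∃ (z₀ : ℂ) (k : ℕ → ℕ) (z : ℕ → ℂ) (ρ : ℕ → ℝ),
        Tendsto k atTop atTop ∧
        Tendsto z atTop (𝓝 z₀) ∧
        (∀ n, 0 < ρ n) ∧ Tendsto ρ atTop (𝓝 0) ∧
        SphLocUnifConv
          (fun n ζ => ((ρ n ^ (-α) : ℝ) : ℂ) * h ((k n : ℂ) * z n + (k n : ℂ) * (ρ n : ℂ) * ζ))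
          g }

/-- Every sequence in a proper normed group has a subsequence that either converges or whose norm
tends to infinity. -/
theorem exists_subseq_tendsto_or_norm_atTop {E : Type*} [NormedAddCommGroup E] [ProperSpace E]
    (u : ℕ → E) :
    ∃ φ : ℕ → ℕ, StrictMono φ ∧
      ((∃ a, Tendsto (fun n => u (φ n)) atTop (𝓝 a)) ∨
        Tendsto (fun n => ‖u (φ n)‖) atTop atTop) := by
  by_cases h : Tendsto (fun n => ‖u n‖) atTop atTop
  · exact ⟨id, strictMono_id, Or.inr h⟩
  · rw [tendsto_atTop] at h
    push Not at h
    obtain ⟨b, hb⟩ := h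
    have hfreq : ∃ᶠ n in atTop, u n ∈ Metric.closedBall (0 : E) b :=
      hb.mono fun n hn => by simpa using hn.le
    obtain ⟨a, -, φ, hφ, ha⟩ :=
      tendsto_subseq_of_frequently_bounded Metric.isBounded_closedBall hfreq
    exact ⟨φ, hφ, Or.inl ⟨a, ha⟩⟩

/-- Spherical locally uniform convergence implies pointwise convergence in the same sense. -/
theorem SphLocUnifConv.tendsto_or_tendsto_inv {F : ℕ → ℂ → ℂ} {g : ℂ → ℂ}
    (h : SphLocUnifConv F g) (w : ℂ) :
    Tendsto (fun n => F n w) atTop (𝓝 (g w)) ∨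
      ((∀ᶠ n in atTop, F n w ≠ 0) ∧ Tendsto (fun n => (F n w)⁻¹) atTop (𝓝 (g w)⁻¹)) := by
  obtain ⟨U, hU, h | ⟨h0, h⟩⟩ := h w
  · exact Or.inl (h.tendsto_at (mem_of_mem_nhds hU))
  · exact Or.inr ⟨h0.mono fun n hn => hn w (mem_of_mem_nhds hU),
      h.tendsto_at (mem_of_mem_nhds hU)⟩

/-- A finite subsequential pointwise limit agrees with the spherical limit. -/
theorem SphLocUnifConv.eq_of_tendsto {F : ℕ → ℂ → ℂ} {g : ℂ → ℂ} (h : SphLocUnifConv F g)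
    {φ : ℕ → ℕ} (hφ : Tendsto φ atTop atTop) {w c : ℂ}
    (hc : Tendsto (fun n => F (φ n) w) atTop (𝓝 c)) : g w = c := by
  rcases h.tendsto_or_tendsto_inv w with h1 | ⟨h0, h1⟩
  · exact tendsto_nhds_unique (h1.comp hφ) hc
  · have hone : Tendsto (fun _ : ℕ => (1 : ℂ)) atTop (𝓝 ((g w)⁻¹ * c)) := by
      refine ((h1.comp hφ).mul hc).congr' ?_
      filter_upwards [hφ.eventually h0] with n hn
      exact inv_mul_cancel₀ hn
    have heq : (g w)⁻¹ * c = 1 := tendsto_nhds_unique hone tendsto_const_nhds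
    have hg : g w ≠ 0 := by
      rintro hg
      simp [hg] at heq
    field_simp at heq
    exact heq.symm

/-- At a point where a subsequence escapes to infinity, the spherical limit takes the value `0`
that stands for `∞`. -/
theorem SphLocUnifConv.eq_zero_of_norm_atTop {F : ℕ → ℂ → ℂ} {g : ℂ → ℂ}
    (h : SphLocUnifConv F g) {φ : ℕ → ℕ} (hφ : Tendsto φ atTop atTop) {w : ℂ}
    (hc : Tendsto (fun n => ‖F (φ n) w‖) atTop atTop) : g w = 0 := by
  rcases h.tendsto_or_tendsto_inv w with h1 | ⟨-, h1⟩
  · exact absurd (h1.comp hφ).norm (not_tendsto_nhds_of_tendsto_atTop hc _)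
  · have hinv : Tendsto (fun n => (F (φ n) w)⁻¹) atTop (𝓝 0) := by
      rw [tendsto_zero_iff_norm_tendsto_zero]
      simp only [norm_inv]
      exact hc.inv_tendsto_atTop
    exact inv_eq_zero.mp (tendsto_nhds_unique (h1.comp hφ) hinv)

/-- Affine rescalings `P (a n + b n * ζ)` whose scale `b n` tends to infinity while the centres
`-(a n / b n)` converge have no spherical limit. -/
theorem not_sphLocUnifConv_of_scale_atTop {P : Polynomial ℂ} (hP : 0 < P.degree)
    {a : ℕ → ℂ} {b : ℕ → ℝ} {g : ℂ → ℂ} {φ : ℕ → ℕ} (hφ : Tendsto φ atTop atTop)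
    (hb : Tendsto (fun n => b (φ n)) atTop atTop) {c : ℂ}
    (hc : Tendsto (fun n => a (φ n) / b (φ n)) atTop (𝓝 c)) :
    ¬ SphLocUnifConv (fun n ζ => P.eval (a n + b n * ζ)) g := by
  intro h
  have hpos : ∀ᶠ n in atTop, 0 < b (φ n) := hb.eventually_gt_atTop 0
  obtain ⟨U, hU, h1 | ⟨h0, -⟩⟩ := h (-c)
  · have hne : ∃ᶠ w in 𝓝[≠] (-c), w ∈ U :=
      (eventually_nhdsWithin_of_eventually_nhds hU).frequently
    obtain ⟨w, hwU, hw⟩ := (hne.and_eventually self_mem_nhdsWithin).exists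
    have hsum : c + w ≠ 0 := fun h0 => hw (eq_neg_of_add_eq_zero_right h0)
    have hnorm : Tendsto (fun n => ‖a (φ n) + b (φ n) * w‖) atTop atTop := by
      refine (hb.atTop_mul_pos (norm_pos_iff.mpr hsum) (hc.add_const w).norm).congr' ?_
      filter_upwards [hpos] with n hn
      have hn' : (b (φ n) : ℂ) ≠ 0 := by exact_mod_cast hn.ne'
      rw [← Real.norm_of_nonneg hn.le, ← Complex.norm_real, ← norm_mul, Complex.norm_real,
        Real.norm_of_nonneg hn.le]
      congr 1
      field_simp
    exact not_tendsto_nhds_of_tendsto_atTop (P.tendsto_norm_atTop hP hnorm) _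
      ((h1.tendsto_at hwU).comp hφ).norm
  · obtain ⟨r, hr⟩ := Complex.exists_root hP
    have hbC : Tendsto (fun n => r * ((b (φ n))⁻¹ : ℝ)) atTop (𝓝 (r * (0 : ℝ))) :=
      ((Complex.continuous_ofReal.tendsto 0).comp hb.inv_tendsto_atTop).const_mul r
    have hw : Tendsto (fun n => r * ((b (φ n))⁻¹ : ℝ) - a (φ n) / b (φ n)) atTop (𝓝 (-c)) := by
      simpa using hbC.sub hc
    obtain ⟨n, hnU, hn0, hn⟩ :=
      ((hw.eventually hU).and ((hφ.eventually h0).and hpos)).exists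
    refine hn0 _ hnU ?_
    have hn' : (b (φ n) : ℂ) ≠ 0 := by exact_mod_cast hn.ne'
    have hval : a (φ n) + b (φ n) * (r * ((b (φ n))⁻¹ : ℝ) - a (φ n) / b (φ n)) = r := by
      push_cast
      field_simp
      ring
    simpa only [hval] using hr.eq_zero

/-- A nonconstant spherical limit of affine rescalings `P (a n + b n * ζ)`, `b n ≥ 0`, is itself an
affine rescaling of `P`. -/
theorem exists_affine_of_sphLocUnifConv {P : Polynomial ℂ} (hP : 0 < P.degree)
    {a : ℕ → ℂ} {b : ℕ → ℝ} (hb0 : ∀ n, 0 ≤ b n) {g : ℂ → ℂ} (hg : ∀ c : ℂ, g ≠ fun _ => c)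
    (h : SphLocUnifConv (fun n ζ => P.eval (a n + b n * ζ)) g) :
    ∃ (A : ℝ) (C : ℂ), 0 < A ∧ g = fun ζ => P.eval ((A : ℂ) * ζ + C) := by
  have hescape : ∀ φ : ℕ → ℕ, Tendsto φ atTop atTop →
      ¬ ∀ w, Tendsto (fun n => ‖a (φ n) + b (φ n) * w‖) atTop atTop := fun φ hφ hall =>
    hg 0 (funext fun w => h.eq_zero_of_norm_atTop hφ (P.tendsto_norm_atTop hP (hall w)))
  obtain ⟨φ, hφ, ⟨B, hB⟩ | hB⟩ := exists_subseq_tendsto_or_norm_atTop b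
  · obtain ⟨ψ, hψ, hC⟩ := exists_subseq_tendsto_or_norm_atTop (fun n => a (φ n))
    have hφψ : Tendsto (fun n => φ (ψ n)) atTop atTop := (hφ.comp hψ).tendsto_atTop
    have hbw : ∀ w : ℂ, Tendsto (fun n => (b (φ (ψ n)) : ℂ) * w) atTop (𝓝 (B * w)) := fun w =>
      ((Complex.continuous_ofReal.tendsto B).comp (hB.comp hψ.tendsto_atTop)).mul_const w
    rcases hC with ⟨C, hC⟩ | hC
    · have hgeq : g = fun ζ => P.eval ((B : ℂ) * ζ + C) := by
        funext w
        refine h.eq_of_tendsto hφψ ?_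
        rw [add_comm]
        exact (P.continuous.tendsto _).comp (hC.add (hbw w))
      refine ⟨B, C, (ge_of_tendsto' hB fun n => hb0 _).lt_of_ne ?_, hgeq⟩
      rintro rfl
      exact hg (P.eval C) (by simpa using hgeq)
    · refine absurd (fun w => ?_) (hescape _ hφψ)
      refine tendsto_atTop_mono (fun n => ?_) (hC.atTop_add (hbw w).norm.neg)
      have := norm_sub_norm_le (a (φ (ψ n))) (-((b (φ (ψ n)) : ℂ) * w))
      rwa [norm_neg, sub_neg_eq_add, sub_eq_add_neg] at this
  · simp only [Real.norm_of_nonneg (hb0 _)] at hB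
    obtain ⟨ψ, hψ, ⟨c, hc⟩ | hc⟩ :=
      exists_subseq_tendsto_or_norm_atTop (fun n => a (φ n) / b (φ n))
    · exact absurd h (not_sphLocUnifConv_of_scale_atTop hP (hφ.comp hψ).tendsto_atTop
        (hB.comp hψ.tendsto_atTop) hc)
    · refine absurd (fun w => ?_) (hescape _ (hφ.comp hψ).tendsto_atTop)
      have hBψ := hB.comp hψ.tendsto_atTop
      refine tendsto_atTop_mono' _ ?_ (tendsto_atTop_add_const_right _ (-‖w‖) hc)
      filter_upwards [hBψ.eventually_ge_atTop 1] with n hn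
      simp only [Function.comp_apply] at hn ⊢
      have hn0 : (b (φ (ψ n)) : ℂ) ≠ 0 := by
        exact_mod_cast (zero_lt_one.trans_le hn).ne'
      have hfac : a (φ (ψ n)) + b (φ (ψ n)) * w =
          b (φ (ψ n)) * (a (φ (ψ n)) / b (φ (ψ n)) - -w) := by
        field_simp
        ring
      have htri := norm_sub_norm_le (a (φ (ψ n)) / (b (φ (ψ n)) : ℂ)) (-w)
      rw [norm_neg] at htri
      rw [hfac, norm_mul, Complex.norm_real, Real.norm_of_nonneg (hb0 _), ← sub_eq_add_neg]
      exact htri.trans (le_mul_of_one_le_left (norm_nonneg _) hn)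

/-- Every affine rescaling `P (A ζ + C)`, `A > 0`, lies in `Π_0(P)`. -/
theorem affine_mem_piAlpha_zero {P : Polynomial ℂ} (hP : 0 < P.natDegree) {A : ℝ} (hA : 0 < A)
    (C : ℂ) : (fun ζ => P.eval ((A : ℂ) * ζ + C)) ∈ PiAlpha 0 (fun z => P.eval z) := by
  have hA' : (A : ℂ) ≠ 0 := by exact_mod_cast hA.ne'
  refine ⟨fun z _ => ?_, fun c hc => ?_, 0, fun n => n + 1, fun n => C * (1 / ((n : ℂ) + 1)),
    fun n => A * (1 / ((n : ℝ) + 1)), tendsto_add_atTop_nat 1, ?_, fun n => by positivity, ?_, ?_⟩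
  · have hd : Differentiable ℂ (fun ζ => P.eval ((A : ℂ) * ζ + C)) :=
      P.differentiable.comp ((differentiable_id.const_mul _).add_const _)
    exact (hd.analyticAt z).meromorphicAt
  · have hPc : P = Polynomial.C c := Polynomial.funext fun x => by
      have := congrFun hc ((x - C) / A)
      simpa [mul_div_cancel₀ _ hA'] using this
    rw [hPc, Polynomial.natDegree_C] at hP
    exact lt_irrefl 0 hP
  · simpa using (tendsto_one_div_add_atTop_nhds_zero_nat (𝕜 := ℂ)).const_mul C
  · simpa using (tendsto_one_div_add_atTop_nhds_zero_nat (𝕜 := ℝ)).const_mul A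
  · refine fun _ => ⟨Set.univ, univ_mem, Or.inl ?_⟩
    refine fun u hu => Eventually.of_forall fun n ζ _ => mem_uniformity_of_eq hu ?_
    have hn : (n : ℂ) + 1 ≠ 0 := Nat.cast_add_one_ne_zero n
    simp only [neg_zero, Real.rpow_zero, Complex.ofReal_one, one_mul]
    congr 1
    push_cast
    field_simp
    ring

/-- For a nonconstant polynomial `P`,
`Π_0(P) = { ζ ↦ P(Aζ + C) : A > 0 real, C ∈ ℂ }`. -/
theorem piAlpha_zero_polynomial (P : Polynomial ℂ) (hP : 0 < P.natDegree) :
    PiAlpha 0 (fun z => P.eval z) =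
      { g | ∃ (A : ℝ) (C : ℂ), 0 < A ∧ g = fun ζ => P.eval ((A : ℂ) * ζ + C) } := by
  ext g
  constructor
  · rintro ⟨-, hg, z₀, k, z, ρ, -, -, hρ, -, h⟩
    refine exists_affine_of_sphLocUnifConv (Polynomial.natDegree_pos_iff_degree_pos.mp hP)
      (a := fun n => k n * z n) (b := fun n => k n * ρ n)
      (fun n => mul_nonneg (Nat.cast_nonneg _) (hρ n).le) hg ?_
    simpa using h
  · rintro ⟨A, C, hA, rfl⟩
    exact affine_mem_piAlpha_zero hP hA C
end
end

section
/- Let P be a nonconstant polynomial of degree k with leading coefficient L ≠ 0. Then for every real α with −1 < α < 0, Π_α(P) = { ζ ↦ L·(Aζ + C)^k : A a real number with A > 0, C ∈ ℂ }. -/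
open Filter Topology Complex

noncomputable section

section SphericalLimits

variable {F : ℕ → ℂ → ℂ} {g : ℂ → ℂ} {l : Filter ℕ} [l.NeBot]

/-- A spherical limit agrees with any finite pointwise limit along a finer filter. -/
lemma SphLocUnifConv.eq_of_tendsto_s3 (h : SphLocUnifConv F g) (hl : l ≤ atTop) {ζ v : ℂ}
    (hv : Tendsto (fun n => F n ζ) l (𝓝 v)) : g ζ = v := by
  obtain ⟨U, hU, hc | ⟨hne, hc⟩⟩ := h ζ
  · exact tendsto_nhds_unique ((hc.tendsto_at (mem_of_mem_nhds hU)).mono_left hl) hv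
  · have hinv := (hc.tendsto_at (mem_of_mem_nhds hU)).mono_left hl
    have hmul := hinv.mul hv
    have hone : ∀ᶠ n in l, (F n ζ)⁻¹ * F n ζ = 1 := by
      filter_upwards [hne.filter_mono hl] with n hn
      exact inv_mul_cancel₀ (hn ζ (mem_of_mem_nhds hU))
    have hgv : (g ζ)⁻¹ * v = 1 :=
      tendsto_nhds_unique hmul (tendsto_const_nhds.congr' (hone.mono fun _ hn => hn.symm))
    have hg : g ζ ≠ 0 := fun h0 => by simp [h0] at hgv
    field_simp at hgv
    exact hgv.symm

/-- If the functions tend to infinity, along a finer filter, at all points of a punctured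
neighborhood of `ζ`, then the spherical limit takes the value `∞` (that is, the
conventional value `0`) at `ζ`. -/
lemma SphLocUnifConv.eq_zero_of_tendsto_atTop (h : SphLocUnifConv F g) (hl : l ≤ atTop)
    (hF : ∀ n, Continuous (F n)) {ζ : ℂ}
    (hinf : ∀ᶠ w in 𝓝[≠] ζ, Tendsto (fun n => ‖F n w‖) l atTop) : g ζ = 0 := by
  obtain ⟨U, hU, hc | ⟨hne, hc⟩⟩ := h ζ
  · obtain ⟨w, hw, hwU⟩ := (hinf.and (mem_nhdsWithin_of_mem_nhds hU)).exists
    exact absurd ((hc.tendsto_at hwU).mono_left hl).norm (not_tendsto_nhds_of_tendsto_atTop hw _)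
  · have hcont : ContinuousOn (fun w => (g w)⁻¹) U := by
      refine hc.continuousOn (Eventually.frequently ?_)
      filter_upwards [hne] with n hn
      exact (hF n).continuousOn.inv₀ hn
    have hlim := (hcont.continuousAt hU).tendsto.mono_left (nhdsWithin_le_nhds (s := {ζ}ᶜ))
    have hzero : ∀ᶠ w in 𝓝[≠] ζ, (g w)⁻¹ = 0 := by
      filter_upwards [hinf, mem_nhdsWithin_of_mem_nhds hU] with w hw hwU
      refine tendsto_nhds_unique ((hc.tendsto_at hwU).mono_left hl) ?_
      rw [tendsto_zero_iff_norm_tendsto_zero]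
      simp only [norm_inv]
      exact hw.inv_tendsto_atTop
    simpa using tendsto_nhds_unique hlim
      (tendsto_const_nhds.congr' (hzero.mono fun _ hw => hw.symm))

end SphericalLimits

/-- The homogenization `s ^ d * P (u / s)` of a polynomial `P` of degree `d`. -/
def homogEval (P : Polynomial ℂ) (s u : ℂ) : ℂ :=
  ∑ i ∈ Finset.range (P.natDegree + 1), P.coeff i * u ^ i * s ^ (P.natDegree - i)

lemma Filter.Tendsto.homogEval (P : Polynomial ℂ) {ι : Type*} {l : Filter ι} {s u : ι → ℂ}
    {s₀ u₀ : ℂ} (hs : Tendsto s l (𝓝 s₀)) (hu : Tendsto u l (𝓝 u₀)) :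
    Tendsto (fun n => homogEval P (s n) (u n)) l (𝓝 (homogEval P s₀ u₀)) :=
  tendsto_finsetSum _ fun i _ => ((hu.pow i).const_mul _).mul (hs.pow _)

lemma Continuous.homogEval (P : Polynomial ℂ) {X : Type*} [TopologicalSpace X] {s u : X → ℂ}
    (hs : Continuous s) (hu : Continuous u) : Continuous fun x => homogEval P (s x) (u x) :=
  continuous_iff_continuousAt.2 fun x => (hs.tendsto x).homogEval P (hu.tendsto x)

lemma homogEval_zero (P : Polynomial ℂ) (u : ℂ) :
    homogEval P 0 u = P.leadingCoeff * u ^ P.natDegree := by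
  rw [homogEval, Finset.sum_range_succ, Finset.sum_eq_zero]
  · simp
  · intro i hi
    have : P.natDegree - i ≠ 0 := by have := Finset.mem_range.1 hi; omega
    simp [this]

lemma homogEval_mul (P : Polynomial ℂ) (s w : ℂ) :
    homogEval P s (s * w) = s ^ P.natDegree * P.eval w := by
  rw [homogEval, Polynomial.eval_eq_sum_range, Finset.mul_sum]
  refine Finset.sum_congr rfl fun i hi => ?_
  have : P.natDegree = i + (P.natDegree - i) := by have := Finset.mem_range.1 hi; omega
  conv_rhs => rw [this, pow_add]
  ring

lemma homogEval_eq_pow_mul (P : Polynomial ℂ) (s : ℂ) {u : ℂ} (hu : u ≠ 0) :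
    homogEval P s u = u ^ P.natDegree * homogEval P (s / u) 1 := by
  rw [homogEval, homogEval, Finset.mul_sum]
  refine Finset.sum_congr rfl fun i hi => ?_
  have : P.natDegree = i + (P.natDegree - i) := by have := Finset.mem_range.1 hi; omega
  conv_rhs => rw [this, pow_add]
  rw [← this, one_pow, div_pow]
  field_simp

/-- The homogenization tends to infinity when `s → 0` and `u → ∞`. -/
lemma tendsto_norm_homogEval_atTop {P : Polynomial ℂ} (hP : 0 < P.natDegree) {ι : Type*}
    {l : Filter ι} {s u : ι → ℂ} (hs : Tendsto s l (𝓝 0))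
    (hu : Tendsto (fun n => ‖u n‖) l atTop) :
    Tendsto (fun n => ‖homogEval P (s n) (u n)‖) l atTop := by
  have hL : 0 < ‖P.leadingCoeff‖ := by
    rw [norm_pos_iff, Polynomial.leadingCoeff_ne_zero]
    rintro rfl
    simp at hP
  have hdiv : Tendsto (fun n => s n / u n) l (𝓝 0) := by
    rw [tendsto_zero_iff_norm_tendsto_zero]
    simpa [div_eq_mul_inv] using hs.norm.mul hu.inv_tendsto_atTop
  have hlim : Tendsto (fun n => ‖homogEval P (s n / u n) 1‖) l (𝓝 ‖P.leadingCoeff‖) := by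
    simpa [homogEval_zero] using (hdiv.homogEval P (tendsto_const_nhds (x := (1 : ℂ)))).norm
  refine (((tendsto_pow_atTop hP.ne').comp hu).atTop_mul_pos hL hlim).congr' ?_
  filter_upwards [hu.eventually_gt_atTop 0] with n hn
  rw [homogEval_eq_pow_mul P _ (norm_pos_iff.1 hn)]
  simp

lemma tendstoUniformlyOn_homogEval (P : Polynomial ℂ) {ι : Type*} {l : Filter ι} {s : ι → ℂ}
    (hs : Tendsto s l (𝓝 0)) (a c : ℂ) {K : Set ℂ} (hK : IsCompact K) :
    TendstoUniformlyOn (fun n ζ => homogEval P (s n) (a * ζ + c))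
      (fun ζ => P.leadingCoeff * (a * ζ + c) ^ P.natDegree) l K := by
  let Q : C(ℂ × ℂ, ℂ) := ⟨fun p => homogEval P p.1 (a * p.2 + c),
    continuous_fst.homogEval P (by fun_prop)⟩
  have := ContinuousMap.tendsto_iff_forall_isCompact_tendstoUniformlyOn.1
    ((Q.curry.continuous.tendsto 0).comp hs) K hK
  refine this.congr_right fun ζ _ => ?_
  exact homogEval_zero P _

/-- The rescaled polynomial in terms of the homogenization. -/
lemma rpow_mul_eval_eq_homogEval {P : Polynomial ℂ} (hP : 0 < P.natDegree) (β : ℝ) {r : ℝ}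
    (hr : 0 < r) (w : ℂ) :
    ((r ^ β : ℝ) : ℂ) * P.eval w =
      homogEval P ((r ^ (β / P.natDegree) : ℝ) : ℂ) (((r ^ (β / P.natDegree) : ℝ) : ℂ) * w) := by
  have hd : (P.natDegree : ℝ) ≠ 0 := by positivity
  rw [homogEval_mul, ← Complex.ofReal_pow, ← Real.rpow_natCast, ← Real.rpow_mul hr.le,
    div_mul_cancel₀ _ hd]

/-- Bounded sequences in a proper space converge along ultrafilters. -/
lemma exists_tendsto_of_norm_le {E : Type*} [NormedAddCommGroup E] [ProperSpace E] {ι : Type*}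
    (l : Ultrafilter ι) {f : ι → E} {R : ℝ} (hf : ∀ᶠ n in (l : Filter ι), ‖f n‖ ≤ R) :
    ∃ x, Tendsto f l (𝓝 x) := by
  obtain ⟨x, -, hx⟩ := (isCompact_closedBall (0 : E) R).ultrafilter_le_nhds' (l.map f)
    (by
      rw [Ultrafilter.mem_map]
      filter_upwards [hf] with n hn
      simpa using hn)
  exact ⟨x, hx⟩

/-- Along an ultrafilter, if affine maps `ζ ↦ a n * ζ + b n` have coefficients tending to infinity
then they tend to infinity pointwise near, but possibly not at, any given point. -/
lemma eventually_tendsto_norm_affine_atTop {ι : Type*} (l : Ultrafilter ι) {a b : ι → ℂ}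
    (h : Tendsto (fun n => ‖a n‖ + ‖b n‖) l atTop) (ζ : ℂ) :
    ∀ᶠ w in 𝓝[≠] ζ, Tendsto (fun n => ‖a n * w + b n‖) l atTop := by
  set T : ι → ℝ := fun n => ‖a n‖ + ‖b n‖
  have hT : ∀ᶠ n in (l : Filter ι), 0 < T n := h.eventually_gt_atTop 0
  obtain ⟨a', ha'⟩ := exists_tendsto_of_norm_le l (f := fun n => a n / T n) (R := 1) (by
    filter_upwards [hT] with n hn
    rw [norm_div, Complex.norm_of_nonneg hn.le, div_le_one hn]
    exact le_add_of_nonneg_right (norm_nonneg _))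
  obtain ⟨b', hb'⟩ := exists_tendsto_of_norm_le l (f := fun n => b n / T n) (R := 1) (by
    filter_upwards [hT] with n hn
    rw [norm_div, Complex.norm_of_nonneg hn.le, div_le_one hn]
    exact le_add_of_nonneg_left (norm_nonneg _))
  have hsum : ‖a'‖ + ‖b'‖ = 1 := by
    refine tendsto_nhds_unique (ha'.norm.add hb'.norm) (tendsto_const_nhds.congr' ?_)
    filter_upwards [hT] with n hn
    rw [norm_div, norm_div, Complex.norm_of_nonneg hn.le, ← add_div, div_self hn.ne']
  have key : ∀ w, a' * w + b' ≠ 0 → Tendsto (fun n => ‖a n * w + b n‖) l atTop := by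
    intro w hw
    refine (h.atTop_mul_pos (norm_pos_iff.2 hw) ((ha'.mul_const w).add hb').norm).congr' ?_
    filter_upwards [hT] with n hn
    change T n * _ = _
    rw [show a n / T n * w + b n / T n = (a n * w + b n) / T n by ring, norm_div,
      Complex.norm_of_nonneg hn.le, mul_div_cancel₀ _ hn.ne']
  by_cases hζ : a' * ζ + b' = 0
  · filter_upwards [self_mem_nhdsWithin] with w hw
    refine key w fun hw0 => ?_
    have : a' * (w - ζ) = 0 := by linear_combination hw0 - hζ
    rcases mul_eq_zero.1 this with ha | hwζ
    · have hb : b' = 0 := by simpa [ha] using hζ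
      simp [ha, hb] at hsum
    · exact hw (sub_eq_zero.1 hwζ)
  · have hcont : ContinuousAt (fun w => a' * w + b') ζ := by fun_prop
    exact ((hcont.eventually_ne hζ).filter_mono nhdsWithin_le_nhds).mono fun w hw => key w hw

/-- A nonconstant spherical limit of `homogEval P (s n) (A n * ζ + B n)`, where `s n → 0` and
`A n ≥ 0`, is of the form `L * (A * ζ + C) ^ d` with `A > 0`. -/
lemma SphLocUnifConv.exists_eq_of_homogEval {P : Polynomial ℂ} (hP : 0 < P.natDegree)
    {s B : ℕ → ℂ} {A : ℕ → ℝ} {g : ℂ → ℂ} (hs : Tendsto s atTop (𝓝 0)) (hA : ∀ n, 0 ≤ A n)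
    (hg : ∀ c : ℂ, g ≠ fun _ => c)
    (h : SphLocUnifConv (fun n ζ => homogEval P (s n) (A n * ζ + B n)) g) :
    ∃ (a : ℝ) (c : ℂ), 0 < a ∧ g = fun ζ => P.leadingCoeff * (a * ζ + c) ^ P.natDegree := by
  let l : Ultrafilter ℕ := hyperfilter ℕ
  have hl : (l : Filter ℕ) ≤ atTop := Nat.hyperfilter_le_atTop
  have hs' := hs.mono_left hl
  by_cases hT : Tendsto (fun n => ‖(A n : ℂ)‖ + ‖B n‖) l atTop
  · refine absurd (funext fun ζ => ?_) (hg 0)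
    refine h.eq_zero_of_tendsto_atTop hl (fun n => ?_)
      ((eventually_tendsto_norm_affine_atTop l hT ζ).mono fun w hw =>
        tendsto_norm_homogEval_atTop hP hs' hw)
    exact continuous_const.homogEval P (by fun_prop)
  · obtain ⟨R, hR⟩ : ∃ R, ∀ᶠ n in (l : Filter ℕ), ‖(A n : ℂ)‖ + ‖B n‖ < R := by
      simp only [tendsto_atTop, not_forall, ← Ultrafilter.eventually_not, not_le] at hT
      exact hT
    obtain ⟨a, ha⟩ := exists_tendsto_of_norm_le l (f := A) (R := R) (by
      filter_upwards [hR] with n hn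
      rw [Complex.norm_real] at hn
      linarith [norm_nonneg (B n)])
    obtain ⟨c, hc⟩ := exists_tendsto_of_norm_le l (f := B) (R := R) (by
      filter_upwards [hR] with n hn
      linarith [norm_nonneg (A n : ℂ)])
    have hgeq : g = fun ζ => P.leadingCoeff * (a * ζ + c) ^ P.natDegree := by
      funext ζ
      refine h.eq_of_tendsto_s3 hl ?_
      have hu : Tendsto (fun n => A n * ζ + B n) l (𝓝 (a * ζ + c)) :=
        (((Complex.continuous_ofReal.tendsto a).comp ha).mul_const ζ).add hc
      rw [← homogEval_zero]
      exact hs'.homogEval P hu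
    have ha0 : 0 ≤ a := ge_of_tendsto' ha hA
    refine ⟨a, c, ha0.lt_of_ne ?_, hgeq⟩
    rintro rfl
    exact hg (P.leadingCoeff * c ^ P.natDegree) (by simpa using hgeq)

lemma const_mul_affine_pow_ne_const {L a : ℂ} (hL : L ≠ 0) (ha : a ≠ 0) (c : ℂ) {d : ℕ}
    (hd : d ≠ 0) (v : ℂ) : (fun ζ => L * (a * ζ + c) ^ d) ≠ fun _ => v := by
  intro h
  have h0 := congrFun h (-c / a)
  have h1 := congrFun h ((1 - c) / a)
  simp only [mul_div_cancel₀ _ ha] at h0 h1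
  simp [hd] at h0 h1
  exact hL (h1.trans h0.symm)

/-- For a nonconstant polynomial `P` of degree `k` with leading
coefficient `L`, for every `-1 < α < 0`,
`Π_α(P) = { ζ ↦ L·(Aζ + C)^k : A > 0 real, C ∈ ℂ }`. -/
theorem piAlpha_polynomial_neg (P : Polynomial ℂ) (hP : 0 < P.natDegree)
    (α : ℝ) (hα₁ : -1 < α) (hα₂ : α < 0) :
    PiAlpha α (fun z => P.eval z) =
      { g | ∃ (A : ℝ) (C : ℂ), 0 < A ∧
          g = fun ζ => P.leadingCoeff * ((A : ℂ) * ζ + C) ^ P.natDegree } := by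
  have hL : P.leadingCoeff ≠ 0 := by
    rw [Polynomial.leadingCoeff_ne_zero]
    rintro rfl
    simp at hP
  set γ : ℝ := -α / P.natDegree with hγ_def
  have hγ : 0 < γ := div_pos (neg_pos.2 hα₂) (Nat.cast_pos.2 hP)
  have hscale : ∀ {ρ : ℕ → ℝ}, Tendsto ρ atTop (𝓝 0) →
      Tendsto (fun n => ((ρ n ^ γ : ℝ) : ℂ)) atTop (𝓝 0) := by
    intro ρ hρ
    have := (Complex.continuous_ofReal.tendsto _).comp (hρ.rpow_const (p := γ) (Or.inr hγ.le))
    simpa [Real.zero_rpow hγ.ne', Function.comp_def] using this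
  ext g
  constructor
  · rintro ⟨-, hg, z₀, k, z, ρ, -, -, hρ, hρ0, h⟩
    refine SphLocUnifConv.exists_eq_of_homogEval hP (s := fun n => ((ρ n ^ γ : ℝ) : ℂ))
      (A := fun n => ρ n ^ γ * (k n * ρ n)) (B := fun n => ((ρ n ^ γ : ℝ) : ℂ) * (k n * z n))
      (hscale hρ0) (fun n => ?_) hg ?_
    · have := hρ n
      positivity
    · convert h using 3 with n ζ
      rw [rpow_mul_eval_eq_homogEval hP _ (hρ n)]
      push_cast
      congr 1
      ring
  · rintro ⟨A, C, hA, rfl⟩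
    have hγ1 : 0 < 1 + γ := by positivity
    let ρ : ℕ → ℝ := fun n => (A / ((n : ℝ) + 1)) ^ (1 + γ)⁻¹
    have hρ : ∀ n, 0 < ρ n := fun n => by positivity
    have hρ0 : Tendsto ρ atTop (𝓝 0) := by
      have h0 : Tendsto (fun n : ℕ => A / ((n : ℝ) + 1)) atTop (𝓝 0) :=
        tendsto_const_nhds.div_atTop (tendsto_natCast_atTop_atTop.atTop_add tendsto_const_nhds)
      have := h0.rpow_const (p := (1 + γ)⁻¹) (Or.inr (by positivity))
      rwa [Real.zero_rpow (by positivity)] at this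
    have hρA : ∀ n, ρ n ^ γ * (((n + 1 : ℕ) : ℝ) * ρ n) = A := by
      intro n
      have h1 : ρ n * ρ n ^ γ = A / ((n : ℝ) + 1) := by
        rw [← Real.rpow_one_add' (hρ n).le hγ1.ne', ← Real.rpow_mul (by positivity),
          inv_mul_cancel₀ hγ1.ne', Real.rpow_one]
      have h2 : (n : ℝ) + 1 ≠ 0 := by positivity
      push_cast
      rw [show ρ n ^ γ * (((n : ℝ) + 1) * ρ n) = (n + 1) * (ρ n * ρ n ^ γ) by ring, h1,
        mul_div_cancel₀ _ h2]
    have hA' : (A : ℂ) ≠ 0 := Complex.ofReal_ne_zero.2 hA.ne'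
    refine ⟨fun x _ => by fun_prop, const_mul_affine_pow_ne_const hL hA' C hP.ne',
      0, fun n => n + 1, fun n => C / A * ρ n, ρ, tendsto_add_atTop_nat 1, ?_, hρ, hρ0, ?_⟩
    · simpa using ((Complex.continuous_ofReal.tendsto 0).comp hρ0).const_mul (C / A)
    · intro ζ₀
      refine ⟨Metric.closedBall ζ₀ 1, Metric.closedBall_mem_nhds ζ₀ one_pos, Or.inl ?_⟩
      convert tendstoUniformlyOn_homogEval P (hscale hρ0) A C (isCompact_closedBall ζ₀ 1)
        using 3 with n ζ
      rw [rpow_mul_eval_eq_homogEval hP _ (hρ n)]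
      congr 1
      have hAn : ((ρ n ^ γ : ℝ) : ℂ) * (((n + 1 : ℕ) : ℂ) * (ρ n : ℂ)) = A := by
        exact_mod_cast congrArg ((↑) : ℝ → ℂ) (hρA n)
      rw [← hγ_def]
      have hC : C / A * A = C := div_mul_cancel₀ C hA'
      linear_combination (ζ + C / A) * hAn + hC
end
end
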